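/- Let L > 0, n ≥ 1, λₙ = n²π²/L², and a ∈ L¹(0,L) with λₙ ≺ a. Suppose there exist 0 = y₀ < y₁ < … < y_{2n+1} < y_{2n+2} = L such that for every 0 ≤ i ≤ 2n+1: y_{i+1} - y_i < L/(2n) and ‖a - λₙ‖_{L¹(y_i, y_{i+1})} < (nπ/L) · cot(nπ(y_{i+1}-y_i)/L). Then the Neumann problem u'' + au = 0, u'(0) = u'(L) = 0 has only the trivial solution. -/

import Mathlib

open MeasureTheory Real Set intervalIntegral


/-- If `v` is integrable, everything is regular. -/
lemma regular_of_int (L : ℝ) (hL : 0 ≤ L) (a u v : ℝ → ℝ)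
    (ha : IntervalIntegrable a volume 0 L)
    (hu : ∀ x ∈ Icc (0:ℝ) L, u x = u 0 + ∫ t in (0:ℝ)..x, v t)
    (hv : ∀ x ∈ Icc (0:ℝ) L, v x = - ∫ t in (0:ℝ)..x, a t * u t)
    (hvi : IntervalIntegrable v volume 0 L) :
    ContinuousOn u (Icc 0 L) ∧ ContinuousOn v (Icc 0 L) ∧
      IntervalIntegrable (fun t => a t * u t) volume 0 L := by
  have h1 : ContinuousOn u (Icc 0 L) := by
    have := continuousOn_primitive_interval' hvi (a := 0) (by simp)
    rw [uIcc_of_le hL] at this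
    exact (continuousOn_const.add this).congr hu
  have h2 : IntervalIntegrable (fun t => a t * u t) volume 0 L :=
    ha.mul_continuousOn (by rwa [uIcc_of_le hL])
  refine ⟨h1, ?_, h2⟩
  have := continuousOn_primitive_interval' h2 (a := 0) (by simp)
  rw [uIcc_of_le hL] at this
  exact this.neg.congr hv

lemma sub_int {f : ℝ → ℝ} {a b c d : ℝ} (h : IntervalIntegrable f volume a b) (hac : a ≤ c)
    (hcd : c ≤ d) (hdb : d ≤ b) : IntervalIntegrable f volume c d :=
  h.mono_set (by rw [uIcc_of_le hcd, uIcc_of_le (by linarith)]; exact Icc_subset_Icc hac hdb)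

lemma regular (L : ℝ) (hL : 0 < L) (a u v : ℝ → ℝ)
    (ha : IntervalIntegrable a volume 0 L)
    (hu : ∀ x ∈ Icc (0:ℝ) L, u x = u 0 + ∫ t in (0:ℝ)..x, v t)
    (hv : ∀ x ∈ Icc (0:ℝ) L, v x = - ∫ t in (0:ℝ)..x, a t * u t) :
    ContinuousOn u (Icc 0 L) ∧ ContinuousOn v (Icc 0 L) ∧
      IntervalIntegrable (fun t => a t * u t) volume 0 L := by
  apply regular_of_int L hL.le a u v ha hu hv
  set J : Set ℝ := {x | x ∈ Icc 0 L ∧ IntervalIntegrable (fun t => a t * u t) volume 0 x} with hJ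
  have h0J : (0:ℝ) ∈ J := ⟨⟨le_rfl, hL.le⟩, by simp⟩
  have hbdd : BddAbove J := ⟨L, fun x hx => hx.1.2⟩
  set S := sSup J with hS
  have hS0 : 0 ≤ S := le_csSup hbdd h0J
  have hSL : S ≤ L := csSup_le ⟨0, h0J⟩ fun x hx => hx.1.2
  have hltS : ∀ x, 0 ≤ x → x < S → IntervalIntegrable (fun t => a t * u t) volume 0 x := by
    intro x hx0 hxS
    obtain ⟨z, hz, hxz⟩ := exists_lt_of_lt_csSup ⟨0, h0J⟩ hxS
    exact sub_int hz.2 le_rfl hx0 hxz.le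
  have hgtS : ∀ x, S < x → x ≤ L → v x = 0 := by
    intro x hSx hxL
    rw [hv x ⟨by linarith, hxL⟩, intervalIntegral.integral_undef, neg_zero]
    intro h
    exact absurd (le_csSup hbdd (⟨⟨by linarith, hxL⟩, h⟩ : x ∈ J)) (not_le.2 hSx)
  -- continuity on [0,x], x < S
  have hvc : ∀ x, 0 ≤ x → x < S → ContinuousOn v (Icc 0 x) := by
    intro x hx0 hxS
    have := continuousOn_primitive_interval' (hltS x hx0 hxS) (a := 0) (by simp)
    rw [uIcc_of_le hx0] at this
    exact this.neg.congr fun y hy => hv y ⟨hy.1, by linarith [hy.2]⟩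
  have hvi : ∀ x, 0 ≤ x → x < S → IntervalIntegrable v volume 0 x := by
    intro x hx0 hxS
    apply ContinuousOn.intervalIntegrable
    rw [uIcc_of_le hx0]
    exact hvc x hx0 hxS
  have huc : ∀ x, 0 ≤ x → x < S → ContinuousOn u (Icc 0 x) := by
    intro x hx0 hxS
    have := continuousOn_primitive_interval' (hvi x hx0 hxS) (a := 0) (by simp)
    rw [uIcc_of_le hx0] at this
    exact (continuousOn_const.add this).congr fun y hy => hu y ⟨hy.1, by linarith [hy.2]⟩
  -- measurability
  have hvIco : ContinuousOn v (Ico 0 S) := by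
    intro x hx
    obtain ⟨z, hz1, hz2⟩ := exists_between hx.2
    have h1 := hvc z (by linarith [hx.1]) hz2 x ⟨hx.1, hz1.le⟩
    refine h1.mono_of_mem_nhdsWithin ?_
    rw [mem_nhdsWithin]
    exact ⟨Iio z, isOpen_Iio, hz1, fun y hy => ⟨hy.2.1, (le_of_lt hy.1)⟩⟩
  -- bound
  have hbound : ∃ C, ∀ x ∈ Ico 0 S, |v x| ≤ C := by
    rcases eq_or_lt_of_le hS0 with h | hSpos
    · exact ⟨0, fun x hx => by rw [← h] at hx; simp at hx⟩
    have hg : IntervalIntegrable (fun t => 1 + |a t|) volume 0 L :=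
      (continuous_const.intervalIntegrable _ _).add ha.abs
    have hgS := sub_int hg le_rfl hS0 hSL
    obtain ⟨s, hs0, hsS, hs⟩ : ∃ s, 0 ≤ s ∧ s < S ∧ (∫ t in s..S, (1 + |a t|)) < 1 / 2 := by
      have h1 := continuousOn_primitive_interval' hgS (a := S) (by simp)
      rw [uIcc_of_le hS0] at h1
      have h2 := (h1 S ⟨hS0, le_rfl⟩).eventually
        (Metric.ball_mem_nhds _ (show (0:ℝ) < 1 / 2 by norm_num))
      have h3 : Iio S ∩ Icc 0 S ∈ nhdsWithin S (Ico 0 S) := by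
        refine Filter.mem_of_superset self_mem_nhdsWithin fun x hx => ⟨hx.2, hx.1, hx.2.le⟩
      have h4 := h2.filter_mono (nhdsWithin_mono S Ico_subset_Icc_self)
      have : (nhdsWithin S (Ico 0 S)).NeBot := by
        rw [← mem_closure_iff_nhdsWithin_neBot, closure_Ico hSpos.ne]
        exact ⟨hS0, le_rfl⟩
      obtain ⟨s, hsa, hsb⟩ := (h4.and h3).exists
      refine ⟨s, hsb.2.1, hsb.1, ?_⟩
      simp only [intervalIntegral.integral_same, Metric.mem_ball, dist_zero_right] at hsa
      rw [intervalIntegral.integral_symm, norm_neg] at hsa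
      exact lt_of_le_of_lt (le_abs_self _) hsa
    obtain ⟨C1, hC1⟩ := (isCompact_Icc (a := (0:ℝ)) (b := s)).exists_bound_of_continuousOn
      (hvc s hs0 hsS)
    refine ⟨max C1 (2 * (|u s| + |v s|)), fun x hx => ?_⟩
    rcases le_total x s with hxs | hsx
    · exact le_max_of_le_left (hC1 x ⟨hx.1, hxs⟩)
    apply le_max_of_le_right
    have hcu : ContinuousOn (fun t => |u t| + |v t|) (Icc s x) :=
      ((huc x hx.1 hx.2).mono (Icc_subset_Icc_left hs0)).abs.add
        ((hvc x hx.1 hx.2).mono (Icc_subset_Icc_left hs0)).abs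
    obtain ⟨m, hm, hmax⟩ := isCompact_Icc.exists_isMaxOn (nonempty_Icc.2 hsx) hcu
    set M := |u m| + |v m| with hM
    have hmS : m < S := lt_of_le_of_lt hm.2 hx.2
    have hm0 : 0 ≤ m := hs0.trans hm.1
    have hfi := hltS m hm0 hmS
    have e1 : u m = u s + ∫ t in s..m, v t := by
      rw [hu m ⟨hm0, by linarith⟩, hu s ⟨hs0, by linarith⟩, add_assoc,
        integral_add_adjacent_intervals (hvi s hs0 hsS) (sub_int (hvi m hm0 hmS) hs0 hm.1 le_rfl)]
    have e2 : v m = v s - ∫ t in s..m, a t * u t := by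
      rw [hv m ⟨hm0, by linarith⟩, hv s ⟨hs0, by linarith⟩, 
        ← integral_add_adjacent_intervals (hltS s hs0 hsS) (sub_int hfi hs0 hm.1 le_rfl)]
      ring
    have hvs := sub_int (hvi m hm0 hmS) hs0 hm.1 le_rfl
    have hfs := sub_int hfi hs0 hm.1 le_rfl
    have e3 : |∫ t in s..m, v t| + |∫ t in s..m, a t * u t| ≤ M * ∫ t in s..m, (1 + |a t|) := by
      calc _ ≤ (∫ t in s..m, |v t|) + ∫ t in s..m, |a t * u t| :=
            add_le_add (abs_integral_le_integral_abs hm.1) (abs_integral_le_integral_abs hm.1)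
        _ = ∫ t in s..m, (|v t| + |a t * u t|) := (integral_add hvs.abs hfs.abs).symm
        _ ≤ ∫ t in s..m, M * (1 + |a t|) := by
            apply integral_mono_on hm.1 (hvs.abs.add hfs.abs)
              ((sub_int hg hs0 hm.1 (by linarith)).const_mul M)
            intro t ht
            have h5 : |u t| + |v t| ≤ M := hmax ⟨ht.1, ht.2.trans hm.2⟩
            rw [abs_mul]
            nlinarith [abs_nonneg (a t), abs_nonneg (u t), abs_nonneg (v t),
              mul_nonneg (abs_nonneg (a t)) (abs_nonneg (v t)),
              mul_le_mul_of_nonneg_left h5 (abs_nonneg (a t))]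
        _ = _ := intervalIntegral.integral_const_mul _ _
    have e4 : (∫ t in s..m, (1 + |a t|)) ≤ ∫ t in s..S, (1 + |a t|) := by
      rw [← integral_add_adjacent_intervals (sub_int hg hs0 hm.1 (by linarith))
        (sub_int hg hm0 hmS.le hSL)]
      have : 0 ≤ ∫ t in m..S, (1 + |a t|) :=
        intervalIntegral.integral_nonneg hmS.le fun t _ => by positivity
      linarith
    have hM0 : 0 ≤ M := by positivity
    have e5 : M ≤ |u s| + |v s| + M * (1 / 2) := by
      have h6 : |u m| ≤ |u s| + |∫ t in s..m, v t| := by rw [e1]; exact abs_add_le _ _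
      have h7 : |v m| ≤ |v s| + |∫ t in s..m, a t * u t| := by rw [e2]; exact abs_sub _ _
      have h8 := mul_le_mul_of_nonneg_left (e4.trans hs.le) hM0
      linarith
    have h9 : |u x| + |v x| ≤ M := hmax ⟨hsx, le_rfl⟩
    linarith [abs_nonneg (u x)]
  obtain ⟨C, hC⟩ := hbound
  have i1 : IntegrableOn v (Ico 0 S) := by
    refine Integrable.of_bound (hvIco.aestronglyMeasurable measurableSet_Ico) C ?_
    filter_upwards [ae_restrict_mem measurableSet_Ico] with x hx
    exact hC x hx
  have i2 : IntegrableOn v (Ioc S L) := by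
    refine IntegrableOn.congr_fun (f := fun _ => (0:ℝ)) integrableOn_zero (fun x hx => ?_)
      measurableSet_Ioc
    exact (hgtS x hx.1 hx.2).symm
  have i3 : IntervalIntegrable v volume 0 S := by
    rw [intervalIntegrable_iff_integrableOn_Ico_of_le hS0]; exact i1
  have i4 : IntervalIntegrable v volume S L := by
    rw [intervalIntegrable_iff_integrableOn_Ioc_of_le hSL]; exact i2
  exact i3.trans i4


lemma weak_form (L : ℝ) (hL : 0 < L) (f V : ℝ → ℝ)
    (hf : IntervalIntegrable f volume 0 L) 
    (hV : ∀ x ∈ Icc (0:ℝ) L, V x = - ∫ t in (0:ℝ)..x, f t) (hVL : V L = 0)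
    (ψ ψ' : ℝ → ℝ) (hψ : ∀ x, HasDerivAt ψ (ψ' x) x) (hψ' : Continuous ψ') :
    ∫ x in (0:ℝ)..L, V x * ψ' x = ∫ x in (0:ℝ)..L, f x * ψ x := by
  have hd : deriv ψ = ψ' := funext fun x => (hψ x).deriv
  have hψ1 : ContDiff ℝ 1 ψ := contDiff_one_iff_deriv.2
    ⟨fun x => (hψ x).differentiableAt, by rwa [hd]⟩
  have h1 := hf.absolutelyContinuousOnInterval_intervalIntegral (c := 0) (by simp)
  have h2 : AbsolutelyContinuousOnInterval ψ 0 L := 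
    hψ1.contDiffOn.absolutelyContinuousOnInterval
  have h3 := h1.integral_mul_deriv_eq_deriv_mul h2
  rw [hd] at h3
  have h0 := hV L ⟨hL.le, le_rfl⟩
  have h00 : (∫ t in (0:ℝ)..L, f t) = 0 := by linarith
  simp only [h00, intervalIntegral.integral_same, zero_mul, sub_zero, zero_sub] at h3
  have h4 : ∫ x in (0:ℝ)..L, V x * ψ' x = - ∫ x in (0:ℝ)..L, (∫ t in (0:ℝ)..x, f t) * ψ' x := by
    rw [← intervalIntegral.integral_neg]
    apply integral_congr
    intro x hx
    rw [uIcc_of_le hL.le] at hx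
    simp only [hV x hx, neg_mul]
  rw [h4, h3, neg_neg]
  apply intervalIntegral.integral_congr_ae
  filter_upwards [hf.ae_hasDerivAt_integral] with x hx hx2
  rw [(hx (uIoc_subset_uIcc hx2) 0 (by simp)).deriv]


lemma riccati_aux (k b c d : ℝ) (hcd : c ≤ d) (φ φ' : ℝ → ℝ)
    (hφ : ∀ x, HasDerivAt φ (φ' x) x) (hφ' : Continuous φ')
    (hcos : ∀ x ∈ Icc c d, cos (k * x + b) ≠ 0) :
    φ c ^ 2 * (k * tan (k * c + b)) - φ d ^ 2 * (k * tan (k * d + b)) ≤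
      ∫ x in c..d, (φ' x ^ 2 - k ^ 2 * φ x ^ 2) := by
  have hφc : Continuous φ := continuous_iff_continuousAt.2 fun x => (hφ x).continuousAt
  have htan : ContinuousOn (fun x => tan (k * x + b)) (Icc c d) := by
    intro x hx
    have h1 : ContinuousAt (fun x => tan (k * x + b)) x :=
      ContinuousAt.comp (f := fun x => k * x + b) (g := tan)
        (continuousAt_tan.2 (hcos x hx)) (by fun_prop)
    exact h1.continuousWithinAt
  have hder : ∀ x ∈ uIcc c d, HasDerivAt (fun x => -(φ x ^ 2 * (k * tan (k * x + b))))
      (-(2 * φ x * φ' x * (k * tan (k * x + b))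
        + φ x ^ 2 * (k * (k * (1 + tan (k * x + b) ^ 2))))) x := by
    intro x hx
    rw [uIcc_of_le hcd] at hx
    have h1 : HasDerivAt (fun x => k * x + b) k x := by
      simpa using ((hasDerivAt_id x).const_mul k).add_const b
    have h2 := (hasDerivAt_tan (hcos x hx)).comp x h1
    have h3 := (((hφ x).pow 2).mul (h2.const_mul k)).neg
    refine h3.congr_deriv ?_
    have hc := hcos x hx
    rw [tan_eq_sin_div_cos]
    simp only [Function.comp, tan_eq_sin_div_cos, Pi.pow_apply]
    have hs := sin_sq_add_cos_sq (k * x + b)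
    field_simp
    push_cast
    have : sin (k*x+b)^2 = 1 - cos (k*x+b)^2 := by linarith
    ring_nf
    ring_nf at this
    rw [this]; ring
  have hcont : ContinuousOn (fun x => -(2 * φ x * φ' x * (k * tan (k * x + b))
        + φ x ^ 2 * (k * (k * (1 + tan (k * x + b) ^ 2))))) (uIcc c d) := by
    rw [uIcc_of_le hcd]
    fun_prop
  have hF := integral_eq_sub_of_hasDerivAt hder hcont.intervalIntegrable
  have hle : (∫ x in c..d, -(2 * φ x * φ' x * (k * tan (k * x + b))
        + φ x ^ 2 * (k * (k * (1 + tan (k * x + b) ^ 2))))) ≤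
      ∫ x in c..d, (φ' x ^ 2 - k ^ 2 * φ x ^ 2) := by
    apply integral_mono_on hcd hcont.intervalIntegrable
    · exact Continuous.intervalIntegrable (by fun_prop) _ _
    · intro x _
      nlinarith [sq_nonneg (φ' x + φ x * (k * tan (k * x + b)))]
  rw [hF] at hle
  linarith

lemma trig_aux (A B : ℝ) (hA : 0 < A) (hB : 0 ≤ B) (hAB : A + B < π / 2) :
    cot (A + B) ≤ tan (π / 2 - A) - tan B := by
  have h1 : 0 < sin A := sin_pos_of_pos_of_lt_pi hA (by linarith [pi_pos])
  have h2 : 0 < cos B := cos_pos_of_mem_Ioo ⟨by linarith [pi_pos], by linarith⟩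
  have h3 : 0 < cos (A + B) := cos_pos_of_mem_Ioo ⟨by linarith [pi_pos], by linarith⟩
  have h4 : 0 < sin (A + B) := sin_pos_of_pos_of_lt_pi (by linarith) (by linarith [pi_pos])
  have h5 : 0 ≤ sin B := sin_nonneg_of_nonneg_of_le_pi hB (by linarith [pi_pos])
  have h6 : 0 < cos A := cos_pos_of_mem_Ioo ⟨by linarith [pi_pos], by linarith⟩
  rw [cot_eq_cos_div_sin, tan_eq_sin_div_cos, tan_eq_sin_div_cos, sin_pi_div_two_sub,
    cos_pi_div_two_sub]
  have : cos A / sin A - sin B / cos B = cos (A + B) / (sin A * cos B) := by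
    rw [cos_add]; field_simp
  rw [this]
  apply div_le_div_of_nonneg_left h3.le (by positivity)
  rw [sin_add]
  nlinarith [mul_nonneg h6.le h5]

lemma pos_right (k c d : ℝ) (hk : 0 < k) (hcd : c < d) (hkd : k * (d - c) < π / 2)
    (q : ℝ → ℝ) (hq : IntervalIntegrable q volume c d)
    (hq0 : ∀ᵐ x ∂(volume.restrict (Ioc c d)), 0 ≤ q x)
    (hqI : (∫ x in c..d, q x) < k * cot (k * (d - c)))
    (φ φ' : ℝ → ℝ)
    (hφ : ∀ x, HasDerivAt φ (φ' x) x) (hφ' : Continuous φ') (hd : φ d = 0) :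
    ∃ δ > 0, ∀ t ∈ Icc c d, δ * φ t ^ 2 ≤
      ∫ x in c..d, (φ' x ^ 2 - k ^ 2 * φ x ^ 2 - q x * φ x ^ 2) := by
  have hφc : Continuous φ := continuous_iff_continuousAt.2 fun x => (hφ x).continuousAt
  obtain ⟨e, hde, hke, hqe⟩ : ∃ e, d < e ∧ k * (e - c) < π / 2 ∧
      (∫ x in c..d, q x) < k * cot (k * (e - c)) := by
    have h1 : ContinuousAt (fun e => k * (e - c)) d := by fun_prop
    have hs : sin (k * (d - c)) ≠ 0 := (sin_pos_of_pos_of_lt_pi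
      (mul_pos hk (by linarith)) (by linarith [pi_pos])).ne'
    have h2 : ContinuousAt (fun e => k * cot (k * (e - c))) d := by
      simp only [cot_eq_cos_div_sin]
      exact continuousAt_const.mul (ContinuousAt.div (by fun_prop) (by fun_prop) hs)
    have h3 := (h1.eventually (gt_mem_nhds hkd)).and (h2.eventually (lt_mem_nhds hqI))
    have h4 := (h3.filter_mono nhdsWithin_le_nhds).and (self_mem_nhdsWithin (s := Ioi d) (a := d))
    obtain ⟨e, ⟨h5, h6⟩, h7⟩ := h4.exists
    exact ⟨e, h7, h5, h6⟩
  refine ⟨k * cot (k * (e - c)) - ∫ x in c..d, q x, by linarith, ?_⟩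
  have hint : ∀ a b, IntervalIntegrable (fun x => φ' x ^ 2 - k ^ 2 * φ x ^ 2) volume a b :=
    fun a b => Continuous.intervalIntegrable (by fun_prop) _ _
  have key : ∀ t ∈ Icc c d, φ t ^ 2 * (k * cot (k * (e - c))) ≤
      ∫ x in c..d, (φ' x ^ 2 - k ^ 2 * φ x ^ 2) := by
    intro t ht
    have hk1 := mul_le_mul_of_nonneg_left ht.1 hk.le
    have hk2 := mul_le_mul_of_nonneg_left ht.2 hk.le
    have hk3 := mul_lt_mul_of_pos_left hde hk
    have h1 := riccati_aux k (-(k * c)) c t ht.1 φ φ' hφ hφ' (by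
      intro x hx
      have := mul_le_mul_of_nonneg_left hx.1 hk.le
      have := mul_le_mul_of_nonneg_left hx.2 hk.le
      apply ne_of_gt
      apply cos_pos_of_mem_Ioo
      constructor <;> linarith [pi_pos])
    have h2 := riccati_aux k (π / 2 - k * e) t d ht.2 φ φ' hφ hφ' (by
      intro x hx
      have := mul_le_mul_of_nonneg_left hx.1 hk.le
      have := mul_le_mul_of_nonneg_left hx.2 hk.le
      apply ne_of_gt
      apply cos_pos_of_mem_Ioo
      constructor <;> linarith [pi_pos])
    rw [← integral_add_adjacent_intervals (hint c t) (hint t d)]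
    have h3 := trig_aux (k * (e - t)) (k * (t - c)) (by nlinarith) (by nlinarith) (by linarith)
    rw [show k * (e - t) + k * (t - c) = k * (e - c) by ring] at h3
    rw [show k * t + -(k * c) = k * (t - c) by ring, show k * c + -(k * c) = 0 by ring, tan_zero] at h1
    rw [hd, show k * t + (π / 2 - k * e) = π / 2 - k * (e - t) by ring] at h2
    have h4 : φ t ^ 2 * (k * cot (k * (e - c))) ≤
        φ t ^ 2 * (k * (tan (π / 2 - k * (e - t)) - tan (k * (t - c)))) := by gcongr
    nlinarith
  obtain ⟨m, hm, hmax⟩ := isCompact_Icc.exists_isMaxOn (nonempty_Icc.2 hcd.le)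
    (f := fun x => φ x ^ 2) (by fun_prop)
  have hqφ : IntervalIntegrable (fun x => q x * φ x ^ 2) volume c d :=
    hq.mul_continuousOn (by fun_prop)
  have hle : ∫ x in c..d, q x * φ x ^ 2 ≤ ∫ x in c..d, q x * φ m ^ 2 := by
    rw [integral_of_le hcd.le, integral_of_le hcd.le]
    apply setIntegral_mono_ae_restrict
    · exact (intervalIntegrable_iff_integrableOn_Ioc_of_le hcd.le).1 hqφ
    · exact (intervalIntegrable_iff_integrableOn_Ioc_of_le hcd.le).1 (hq.mul_const _)
    · filter_upwards [hq0, ae_restrict_mem measurableSet_Ioc] with x hx hx2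
      exact mul_le_mul_of_nonneg_left (hmax ⟨hx2.1.le, hx2.2⟩) hx
  rw [intervalIntegral.integral_mul_const] at hle
  intro t ht
  rw [integral_sub (hint c d) hqφ]
  have h1 := key m hm
  have h2 : φ t ^ 2 ≤ φ m ^ 2 := hmax ht
  nlinarith [mul_le_mul_of_nonneg_left h2 (sub_nonneg.2 hqe.le)]

lemma pos_left (k c d : ℝ) (hk : 0 < k) (hcd : c < d) (hkd : k * (d - c) < π / 2)
    (q : ℝ → ℝ) (hq : IntervalIntegrable q volume c d)
    (hq0 : ∀ᵐ x ∂(volume.restrict (Ioc c d)), 0 ≤ q x)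
    (hqI : (∫ x in c..d, q x) < k * cot (k * (d - c)))
    (φ φ' : ℝ → ℝ)
    (hφ : ∀ x, HasDerivAt φ (φ' x) x) (hφ' : Continuous φ') (hc : φ c = 0) :
    ∃ δ > 0, ∀ t ∈ Icc c d, δ * φ t ^ 2 ≤
      ∫ x in c..d, (φ' x ^ 2 - k ^ 2 * φ x ^ 2 - q x * φ x ^ 2) := by
  have := pos_right k (-d) (-c) hk (by linarith) (by rwa [show -c - -d = d - c by ring])
    (fun x => q (-x)) 
    (by simpa using ((IntervalIntegrable.iff_comp_neg (by simp)).1 hq).symm)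
    (by
      have h1 := (ae_restrict_iff' measurableSet_Ioc).1 hq0
      refine (ae_restrict_iff' measurableSet_Ioc).2 ?_
      have h2 := (Measure.measurePreserving_neg (volume : Measure ℝ)).quasiMeasurePreserving.ae h1
      have h3 : ∀ᵐ x : ℝ, x ≠ -c := by simp [ae_iff, measure_singleton]
      filter_upwards [h2, h3] with x hx hx3 hx2
      exact hx ⟨by rcases lt_or_eq_of_le hx2.2 with h | h
                   · linarith
                   · exact absurd h hx3, by linarith [hx2.1]⟩)
    (by rw [integral_comp_neg]; simpa [show -c + d = d - c by ring] using hqI)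
    (fun x => φ (-x)) (fun x => -φ' (-x))
    (fun x => ((hφ (-x)).comp x (hasDerivAt_neg x)).congr_deriv (by ring))
    (by fun_prop) (by simpa using hc)
  obtain ⟨δ, hδ, h⟩ := this
  refine ⟨δ, hδ, fun t ht => ?_⟩
  have h1 := h (-t) ⟨by linarith [ht.2], by linarith [ht.1]⟩
  have h2 := integral_comp_neg (a := -d) (b := -c) (fun x => φ' x ^ 2 - k ^ 2 * φ x ^ 2 - q x * φ x ^ 2)
  simp only [neg_neg] at h1 h2
  rw [← h2]
  simpa using h1


lemma sin_end (L : ℝ) (hL : 0 < L) (i : ℕ) : sin (π / L * i * L) = 0 := by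
  rw [show π / L * i * L = i * π by field_simp]
  exact sin_nat_mul_pi i

lemma gram_aux (L : ℝ) (hL : 0 < L) (i j : ℕ) :
    π / L * i * (∫ x in (0:ℝ)..L, cos (π / L * i * x) * cos (π / L * j * x)) =
    π / L * j * (∫ x in (0:ℝ)..L, sin (π / L * i * x) * sin (π / L * j * x)) := by
  have hder : ∀ x ∈ uIcc 0 L, HasDerivAt (fun x => sin (π / L * i * x) * cos (π / L * j * x))
      (π / L * i * (cos (π / L * i * x) * cos (π / L * j * x)) -
        π / L * j * (sin (π / L * i * x) * sin (π / L * j * x))) x := by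
    intro x _
    have h1 : HasDerivAt (fun x => π / L * i * x) (π / L * i) x := by
      simpa using (hasDerivAt_id x).const_mul (π / L * i)
    have h2 : HasDerivAt (fun x => π / L * j * x) (π / L * j) x := by
      simpa using (hasDerivAt_id x).const_mul (π / L * j)
    refine (h1.sin.mul h2.cos).congr_deriv ?_
    ring
  have h := integral_eq_sub_of_hasDerivAt hder (Continuous.intervalIntegrable (by fun_prop) _ _)
  rw [integral_sub (Continuous.intervalIntegrable (by fun_prop) _ _)
    (Continuous.intervalIntegrable (by fun_prop) _ _), intervalIntegral.integral_const_mul,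
    intervalIntegral.integral_const_mul, sin_end L hL] at h
  simp at h
  linarith

lemma gram_sin (L : ℝ) (hL : 0 < L) (i j : ℕ) :
    (∫ x in (0:ℝ)..L, (π / L * i * sin (π / L * i * x)) * (π / L * j * sin (π / L * j * x))) =
    (π / L * i) ^ 2 * ∫ x in (0:ℝ)..L, cos (π / L * i * x) * cos (π / L * j * x) := by
  have h := gram_aux L hL i j
  have : (fun x => (π / L * i * sin (π / L * i * x)) * (π / L * j * sin (π / L * j * x))) =
    fun x => (π / L * i) * (π / L * j) * (sin (π / L * i * x) * sin (π / L * j * x)) := by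
    ext x; ring
  rw [this, intervalIntegral.integral_const_mul, mul_assoc, ← h]
  ring

lemma gram_ne (L : ℝ) (hL : 0 < L) (i j : ℕ) (hij : i ≠ j) :
    ∫ x in (0:ℝ)..L, cos (π / L * i * x) * cos (π / L * j * x) = 0 := by
  have h1 := gram_aux L hL i j
  have h2 := gram_aux L hL j i
  simp only [mul_comm (cos (π / L * j * _)), mul_comm (sin (π / L * j * _))] at h2
  set G := ∫ x in (0:ℝ)..L, cos (π / L * i * x) * cos (π / L * j * x)
  set H := ∫ x in (0:ℝ)..L, sin (π / L * i * x) * sin (π / L * j * x)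
  have h3 : (π / L) ^ 2 * ((i:ℝ) - j) * ((i:ℝ) + j) * G = 0 := by
    linear_combination (π / L * i) * h1 - (π / L * j) * h2
  have hp : π / L ≠ 0 := (div_pos pi_pos hL).ne'
  have h4 : (i:ℝ) - j ≠ 0 := sub_ne_zero.2 (by exact_mod_cast hij)
  have h5 : (i:ℝ) + j ≠ 0 := by
    have : i + j ≠ 0 := by omega
    exact_mod_cast this
  simpa [hp, h4, h5] using h3

lemma gram_pos (L : ℝ) (hL : 0 < L) (i : ℕ) :
    0 < ∫ x in (0:ℝ)..L, cos (π / L * i * x) * cos (π / L * i * x) := by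
  apply intervalIntegral.integral_pos hL
  · fun_prop
  · intro x _; exact mul_self_nonneg _
  · exact ⟨0, ⟨le_rfl, hL.le⟩, by simp⟩

lemma sq_sum_int (L : ℝ) {ι : Type*} [Fintype ι] (f : ι → ℝ → ℝ) (hf : ∀ i, Continuous (f i)) :
    ∫ x in (0:ℝ)..L, (∑ i, f i x) ^ 2 = ∑ i, ∑ j, ∫ x in (0:ℝ)..L, f i x * f j x := by
  simp only [sq, Finset.sum_mul_sum]
  rw [intervalIntegral.integral_finsetSum]
  · apply Finset.sum_congr rfl
    intro i _
    rw [intervalIntegral.integral_finsetSum]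
    intro j _
    exact ((hf i).mul (hf j)).intervalIntegrable _ _
  · intro i _
    exact (continuous_finsetSum _ fun j _ => (hf i).mul (hf j)).intervalIntegrable _ _

lemma cos_form (L : ℝ) (hL : 0 < L) (n : ℕ) (β : Fin (n + 1) → ℝ) :
    ∫ x in (0:ℝ)..L, ((∑ j, -(β j * (π / L * (j : ℕ) * sin (π / L * (j : ℕ) * x)))) ^ 2 -
      (π / L * n) ^ 2 * (∑ j, β j * cos (π / L * (j : ℕ) * x)) ^ 2) ≤ 0 := by
  rw [integral_sub (Continuous.intervalIntegrable (by fun_prop) _ _)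
    (Continuous.intervalIntegrable (by fun_prop) _ _), intervalIntegral.integral_const_mul,
    sq_sum_int L (fun (j : Fin (n+1)) x => -(β j * (π / L * (j : ℕ) * sin (π / L * (j : ℕ) * x))))
      (fun j => by fun_prop),
    sq_sum_int L (fun (j : Fin (n+1)) x => β j * cos (π / L * (j : ℕ) * x)) (fun j => by fun_prop),
    Finset.mul_sum, ← Finset.sum_sub_distrib]
  apply Finset.sum_nonpos
  intro i _
  rw [Finset.mul_sum, ← Finset.sum_sub_distrib]
  apply Finset.sum_nonpos
  intro j _
  have e1 : ∫ x in (0:ℝ)..L, -(β i * (π / L * (i : ℕ) * sin (π / L * (i : ℕ) * x))) *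
      -(β j * (π / L * (j : ℕ) * sin (π / L * (j : ℕ) * x))) = 
      β i * β j * ((π / L * (i : ℕ)) ^ 2 *
        ∫ x in (0:ℝ)..L, cos (π / L * (i : ℕ) * x) * cos (π / L * (j : ℕ) * x)) := by
    rw [← gram_sin L hL, ← intervalIntegral.integral_const_mul]
    congr 1; ext x; ring
  have e2 : ∫ x in (0:ℝ)..L, β i * cos (π / L * (i : ℕ) * x) *
      (β j * cos (π / L * (j : ℕ) * x)) = 
      β i * β j * 
        ∫ x in (0:ℝ)..L, cos (π / L * (i : ℕ) * x) * cos (π / L * (j : ℕ) * x) := by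
    rw [← intervalIntegral.integral_const_mul]
    congr 1; ext x; ring
  rw [e1, e2]
  by_cases hij : i = j
  · subst hij
    have hG := gram_pos L hL i
    have hin : ((i : ℕ) : ℝ) ≤ n := by exact_mod_cast Nat.lt_succ_iff.1 i.2
    have hp := div_pos pi_pos hL
    have h1 : (π / L * (i : ℕ)) ^ 2 ≤ (π / L * n) ^ 2 := by gcongr
    nlinarith [mul_nonneg (mul_nonneg (mul_self_nonneg (β i)) hG.le) (sub_nonneg.2 h1)]
  · rw [gram_ne L hL i j (fun h => hij (Fin.ext h))]
    simp

lemma cos_indep (L : ℝ) (hL : 0 < L) (n : ℕ) (β : Fin (n + 1) → ℝ)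
    (h : ∀ x : ℝ, ∑ j, β j * cos (π / L * (j : ℕ) * x) = 0) : β = 0 := by
  ext i
  have h1 : ∫ x in (0:ℝ)..L, (∑ j, β j * cos (π / L * (j : ℕ) * x)) * cos (π / L * (i : ℕ) * x)
      = β i * ∫ x in (0:ℝ)..L, cos (π / L * (i : ℕ) * x) * cos (π / L * (i : ℕ) * x) := by
    simp only [Finset.sum_mul]
    rw [intervalIntegral.integral_finsetSum
      (fun j _ => Continuous.intervalIntegrable (by fun_prop) _ _)]
    simp only [mul_assoc (β _), intervalIntegral.integral_const_mul]
    rw [Finset.sum_eq_single i]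
    · intro j _ hji
      rw [gram_ne L hL j i (fun h => hji (Fin.ext h)), mul_zero]
    · simp
  simp only [h, zero_mul, intervalIntegral.integral_zero] at h1
  have := (gram_pos L hL i).ne'
  simpa [this] using h1.symm

lemma cos_zero (L : ℝ) (n : ℕ) (β : Fin (n + 1) → ℝ) (s : Set ℝ)
    (hs : s ⊆ Icc 0 L) (hpos : 0 < volume s)
    (h : ∀ x ∈ s, ∑ j, β j * cos (π / L * (j : ℕ) * x) = 0) :
    ∀ x : ℝ, ∑ j, β j * cos (π / L * (j : ℕ) * x) = 0 := by
  have hinf : s.Infinite := by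
    intro hfin
    exact hpos.ne' (hfin.measure_zero _)
  obtain ⟨z, -, hz⟩ := hinf.exists_accPt_of_subset_isCompact isCompact_Icc hs
  have han : AnalyticOnNhd ℝ (fun x => ∑ j, β j * cos (π / L * (j : ℕ) * x)) univ := by
    intro x _
    fun_prop
  rw [accPt_iff_frequently_nhdsNE] at hz
  have := han.eqOn_zero_of_preconnected_of_frequently_eq_zero isPreconnected_univ (mem_univ z)
    (hz.mono fun x hx => h x hx)
  intro x
  exact this (mem_univ x)

theorem piecewise_L1_nonresonance (L : ℝ) (hL : 0 < L) (n : ℕ) (hn : 1 ≤ n)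
    (a : ℝ → ℝ)
    (ha : IntegrableOn a (Ioo 0 L))
    (hprec₁ : ∀ᵐ x ∂(volume.restrict (Ioo 0 L)), (n : ℝ) ^ 2 * π ^ 2 / L ^ 2 ≤ a x)
    (hprec₂ : 0 < volume (Ioo 0 L ∩ {x | (n : ℝ) ^ 2 * π ^ 2 / L ^ 2 < a x}))
    (y : ℕ → ℝ) (hy0 : y 0 = 0) (hyL : y (2 * n + 2) = L)
    (hmono : StrictMonoOn y (Iic (2 * n + 2)))
    (hgap : ∀ i ≤ 2 * n + 1, y (i + 1) - y i < L / (2 * n))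
    (hsub : ∀ i ≤ 2 * n + 1,
        (∫ x in y i..y (i + 1), |a x - (n : ℝ) ^ 2 * π ^ 2 / L ^ 2|) <
          (n : ℝ) * π / L * Real.cot ((n : ℝ) * π * (y (i + 1) - y i) / L)) :
    ∀ u v : ℝ → ℝ,
      (∀ x ∈ Icc (0:ℝ) L, u x = u 0 + ∫ t in (0:ℝ)..x, v t) →
      (∀ x ∈ Icc (0:ℝ) L, v x = - ∫ t in (0:ℝ)..x, a t * u t) →
      v L = 0 →
      ∀ x ∈ Icc (0:ℝ) L, u x = 0 := by
  intro u v hu hv hvL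
  have hnpos : (0:ℝ) < n := by exact_mod_cast hn
  have haI : IntervalIntegrable a volume 0 L :=
    (intervalIntegrable_iff_integrableOn_Ioo_of_le hL.le).2 ha
  obtain ⟨-, hvc, -⟩ := regular L hL a u v haI hu hv
  -- global extensions
  set V : ℝ → ℝ := fun x => v (projIcc 0 L hL.le x) with hVdef
  have hVc : Continuous V :=
    (continuousOn_iff_continuous_domRestrict.1 hvc).comp continuous_projIcc
  have hVv : ∀ x ∈ Icc (0:ℝ) L, V x = v x := by
    intro x hx
    simp only [hVdef, projIcc_of_mem hL.le hx]
  set U : ℝ → ℝ := fun x => u 0 + ∫ t in (0:ℝ)..x, V t with hUdef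
  have hUd : ∀ x, HasDerivAt U (V x) x := fun x =>
    (integral_hasDerivAt_right (hVc.intervalIntegrable _ _)
      (hVc.stronglyMeasurableAtFilter _ _) hVc.continuousAt).const_add _
  have hUc : Continuous U := continuous_iff_continuousAt.2 fun x => (hUd x).continuousAt
  have hUu : ∀ x ∈ Icc (0:ℝ) L, U x = u x := by
    intro x hx
    rw [hu x hx]
    simp only [hUdef]
    congr 1
    apply integral_congr
    intro t ht
    rw [uIcc_of_le hx.1] at ht
    exact hVv t ⟨ht.1, ht.2.trans hx.2⟩
  have hVint : ∀ x ∈ Icc (0:ℝ) L, V x = - ∫ t in (0:ℝ)..x, a t * U t := by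
    intro x hx
    rw [hVv x hx, hv x hx]
    congr 1
    apply integral_congr
    intro t ht
    rw [uIcc_of_le hx.1] at ht
    simp only [hUu t ⟨ht.1, ht.2.trans hx.2⟩]
  have hVL : V L = 0 := by rw [hVv L ⟨hL.le, le_rfl⟩, hvL]
  have haU : IntervalIntegrable (fun t => a t * U t) volume 0 L :=
    haI.mul_continuousOn hUc.continuousOn
  have weak := weak_form L hL (fun t => a t * U t) V haU hVint hVL
  -- constants
  set k : ℝ := π / L * n with hk
  have hkpos : 0 < k := mul_pos (div_pos pi_pos hL) hnpos
  have hlam : (n : ℝ) ^ 2 * π ^ 2 / L ^ 2 = k ^ 2 := by rw [hk]; field_simp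
  rw [hlam] at hprec₁ hprec₂
  simp only [hlam] at hsub
  -- the linear algebra
  let F : (ℝ × (Fin (n + 1) → ℝ)) →ₗ[ℝ] (Fin (n + 1) → ℝ) :=
    { toFun := fun c m => c.1 * U (y (2 * m + 1)) +
        ∑ j, c.2 j * cos (π / L * (j : ℕ) * y (2 * m + 1))
      map_add' := by
        intro c d
        ext m
        simp only [Prod.fst_add, Prod.snd_add, Pi.add_apply, add_mul, Finset.sum_add_distrib]
        ring
      map_smul' := by
        intro r c
        ext m
        simp only [Prod.smul_fst, Prod.smul_snd, Pi.smul_apply, smul_eq_mul, RingHom.id_apply,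
          mul_add, Finset.mul_sum, mul_assoc] }
  have hker : LinearMap.ker F ≠ ⊥ := LinearMap.ker_ne_bot_of_finrank_lt (by simp)
  obtain ⟨⟨α, β⟩, hF, hne⟩ := (Submodule.ne_bot_iff _).1 hker
  have hFm : ∀ m : ℕ, m ≤ n → α * U (y (2 * m + 1)) +
      ∑ j, β j * cos (π / L * (j : ℕ) * y (2 * m + 1)) = 0 := by
    intro m hm
    exact congrFun (LinearMap.mem_ker.1 hF) ⟨m, by omega⟩
  set p : ℝ → ℝ := fun x => ∑ j, β j * cos (π / L * (j : ℕ) * x) with hp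
  set p' : ℝ → ℝ := fun x => ∑ j, -(β j * (π / L * (j : ℕ) * sin (π / L * (j : ℕ) * x))) with hp'
  have hpd : ∀ x, HasDerivAt p (p' x) x := by
    intro x
    apply HasDerivAt.fun_sum
    intro j _
    have h1 : HasDerivAt (fun x => π / L * (j : ℕ) * x) (π / L * (j : ℕ)) x := by
      simpa using (hasDerivAt_id x).const_mul (π / L * (j : ℕ))
    exact (h1.cos.const_mul (β j)).congr_deriv (by ring)
  have hpc : Continuous p := by fun_prop
  have hpc' : Continuous p' := by fun_prop
  set φ : ℝ → ℝ := fun x => α * U x + p x with hφdef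
  set φ' : ℝ → ℝ := fun x => α * V x + p' x with hφdef'
  have hφd : ∀ x, HasDerivAt φ (φ' x) x := fun x => ((hUd x).const_mul α).add (hpd x)
  have hφc' : Continuous φ' := by fun_prop
  have hφc : Continuous φ := by fun_prop
  set q : ℝ → ℝ := fun x => a x - k ^ 2 with hq
  have hqI : IntervalIntegrable q volume 0 L := haI.sub (continuous_const.intervalIntegrable _ _)
  have w1 := weak U V hUd hVc
  have w2 := weak p p' hpd hpc'
  have hform := cos_form L hL n β
  change ∫ x in (0:ℝ)..L, (p' x ^ 2 - k ^ 2 * p x ^ 2) ≤ 0 at hform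
  have hqp : IntervalIntegrable (fun x => q x * p x ^ 2) volume 0 L :=
    hqI.mul_continuousOn (by fun_prop)
  have hQ : ∫ x in (0:ℝ)..L, (φ' x ^ 2 - k ^ 2 * φ x ^ 2 - q x * φ x ^ 2) =
      (∫ x in (0:ℝ)..L, (p' x ^ 2 - k ^ 2 * p x ^ 2)) - ∫ x in (0:ℝ)..L, q x * p x ^ 2 := by
    have i1 : IntervalIntegrable (fun x => V x * V x) volume 0 L :=
      Continuous.intervalIntegrable (by fun_prop) _ _
    have i2 : IntervalIntegrable (fun x => a x * U x * U x) volume 0 L :=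
      haU.mul_continuousOn (by fun_prop)
    have i3 : IntervalIntegrable (fun x => V x * p' x) volume 0 L :=
      Continuous.intervalIntegrable (by fun_prop) _ _
    have i4 : IntervalIntegrable (fun x => a x * U x * p x) volume 0 L :=
      haU.mul_continuousOn (by fun_prop)
    have i5 : IntervalIntegrable (fun x => p' x ^ 2 - k ^ 2 * p x ^ 2) volume 0 L :=
      Continuous.intervalIntegrable (by fun_prop) _ _
    have e : ∀ x, φ' x ^ 2 - k ^ 2 * φ x ^ 2 - q x * φ x ^ 2 =
      (α ^ 2 * (V x * V x - a x * U x * U x) + 2 * α * (V x * p' x - a x * U x * p x)) +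
      ((p' x ^ 2 - k ^ 2 * p x ^ 2) - q x * p x ^ 2) := by
      intro x
      simp only [hφdef, hφdef', hq]
      ring
    simp only [e]
    rw [integral_add (((i1.sub i2).const_mul _).add ((i3.sub i4).const_mul _)) (i5.sub hqp),
      integral_add ((i1.sub i2).const_mul _) ((i3.sub i4).const_mul _), integral_sub i5 hqp,
      intervalIntegral.integral_const_mul, intervalIntegral.integral_const_mul,
      integral_sub i1 i2, integral_sub i3 i4, w1, w2]
    ring
  -- nonnegativity of q
  have hq0 : ∀ᵐ x ∂(volume.restrict (Ioc 0 L)), 0 ≤ q x := by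
    rw [← Measure.restrict_congr_set (Ioo_ae_eq_Ioc (μ := volume) (a := (0:ℝ)) (b := L))]
    filter_upwards [hprec₁] with x hx
    exact sub_nonneg.2 hx
  have hqp0 : ∀ᵐ x ∂(volume.restrict (Ioc 0 L)), 0 ≤ q x * p x ^ 2 := by
    filter_upwards [hq0] with x hx
    positivity
  have hqpI : 0 ≤ ∫ x in (0:ℝ)..L, q x * p x ^ 2 := by
    rw [integral_of_le hL.le]
    exact integral_nonneg_of_ae hqp0
  -- partition
  have hlt : ∀ i ≤ 2 * n + 1, y i < y (i + 1) := fun i hi =>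
    hmono (by simp only [mem_Iic]; omega) (by simp only [mem_Iic]; omega) (by omega)
  have hyge : ∀ i ≤ 2 * n + 2, 0 ≤ y i := by
    intro i hi
    rw [← hy0]
    exact hmono.monotoneOn (by simp) (by simpa using hi) (by omega)
  have hyle : ∀ i ≤ 2 * n + 2, y i ≤ L := by
    intro i hi
    rw [← hyL]
    exact hmono.monotoneOn (by simpa using hi) (by simp) (by omega)
  have hpiece : ∀ i ≤ 2 * n + 1, ∃ δ > 0, ∀ t ∈ Icc (y i) (y (i + 1)), δ * φ t ^ 2 ≤
      ∫ x in y i..y (i + 1), (φ' x ^ 2 - k ^ 2 * φ x ^ 2 - q x * φ x ^ 2) := by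
    intro i hi
    have hg : k * (y (i + 1) - y i) < π / 2 := by
      have := mul_lt_mul_of_pos_left (hgap i hi) hkpos
      have e : k * (L / (2 * n)) = π / 2 := by rw [hk]; field_simp
      linarith
    have hqi : IntervalIntegrable q volume (y i) (y (i + 1)) :=
      sub_int hqI (hyge i (by omega)) (hlt i hi).le (hyle (i + 1) (by omega))
    have hqi0 : ∀ᵐ x ∂(volume.restrict (Ioc (y i) (y (i + 1)))), 0 ≤ q x :=
      ae_restrict_of_ae_restrict_of_subset
        (Ioc_subset_Ioc (hyge i (by omega)) (hyle (i + 1) (by omega))) hq0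
    have hqii : (∫ x in y i..y (i + 1), q x) < k * cot (k * (y (i + 1) - y i)) := by
      have h1 : (∫ x in y i..y (i + 1), q x) ≤ ∫ x in y i..y (i + 1), |a x - k ^ 2| :=
        integral_mono_on (hlt i hi).le hqi hqi.abs fun x _ => le_abs_self _
      have h2 := hsub i hi
      rw [show (n : ℝ) * π / L = k by rw [hk]; ring,
        show (n : ℝ) * π * (y (i + 1) - y i) / L = k * (y (i + 1) - y i) by rw [hk]; ring] at h2
      linarith
    rcases Nat.even_or_odd' i with ⟨m, rfl | rfl⟩
    · exact pos_right k _ _ hkpos (hlt _ hi) hg q hqi hqi0 hqii φ φ' hφd hφc' (hFm m (by omega))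
    · exact pos_left k _ _ hkpos (hlt _ hi) hg q hqi hqi0 hqii φ φ' hφd hφc' (hFm m (by omega))
  have hpiece0 : ∀ i ≤ 2 * n + 1, 
      0 ≤ ∫ x in y i..y (i + 1), (φ' x ^ 2 - k ^ 2 * φ x ^ 2 - q x * φ x ^ 2) := by
    intro i hi
    obtain ⟨δ, hδ, h⟩ := hpiece i hi
    exact le_trans (by positivity) (h (y i) ⟨le_rfl, (hlt i hi).le⟩)
  have htot : IntervalIntegrable (fun x => φ' x ^ 2 - k ^ 2 * φ x ^ 2 - q x * φ x ^ 2)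
      volume 0 L :=
    (Continuous.intervalIntegrable (by fun_prop) _ _).sub
      (hqI.mul_continuousOn (by fun_prop))
  have hsum := sum_integral_adjacent_intervals (μ := volume) (a := y) (n := 2 * n + 2)
    (f := fun x => φ' x ^ 2 - k ^ 2 * φ x ^ 2 - q x * φ x ^ 2) (fun i hi =>
      sub_int htot (hyge i (by omega)) (hlt i (by omega)).le (hyle (i + 1) (by omega)))
  rw [hy0, hyL, hQ] at hsum
  have hsum0 : 0 ≤ ∑ i ∈ Finset.range (2 * n + 2),
      ∫ x in y i..y (i + 1), (φ' x ^ 2 - k ^ 2 * φ x ^ 2 - q x * φ x ^ 2) :=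
    Finset.sum_nonneg fun i hi => hpiece0 i (by have := Finset.mem_range.1 hi; omega)
  have hqpz : ∫ x in (0:ℝ)..L, q x * p x ^ 2 = 0 := by linarith
  have hsumz : ∑ i ∈ Finset.range (2 * n + 2),
      ∫ x in y i..y (i + 1), (φ' x ^ 2 - k ^ 2 * φ x ^ 2 - q x * φ x ^ 2) = 0 := by linarith
  have hz := (Finset.sum_eq_zero_iff_of_nonneg fun i hi =>
    hpiece0 i (by have := Finset.mem_range.1 hi; omega)).1 hsumz
  have hφz : ∀ m ≤ 2 * n + 2, ∀ x ∈ Icc 0 (y m), φ x = 0 := by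
    intro m
    induction m with
    | zero =>
      intro _ x hx
      obtain ⟨δ, hδ, h⟩ := hpiece 0 (by omega)
      rw [hy0] at hx
      have hx0 : x = y 0 := by rw [hy0]; exact le_antisymm hx.2 hx.1
      have h1 := h x ⟨hx0.ge, by rw [hx0]; exact (hlt 0 (by omega)).le⟩
      rw [hz 0 (by simp)] at h1
      have : φ x ^ 2 ≤ 0 := by nlinarith
      exact pow_eq_zero_iff (two_ne_zero) |>.1 (le_antisymm this (sq_nonneg _))
    | succ m ih =>
      intro hm x hx
      rcases le_total x (y m) with hxm | hxm
      · exact ih (by omega) x ⟨hx.1, hxm⟩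
      obtain ⟨δ, hδ, h⟩ := hpiece m (by omega)
      have h1 := h x ⟨hxm, hx.2⟩
      rw [hz m (by simp only [Finset.mem_range]; omega)] at h1
      have : φ x ^ 2 ≤ 0 := by nlinarith
      exact pow_eq_zero_iff (two_ne_zero) |>.1 (le_antisymm this (sq_nonneg _))
  have hφ0 : ∀ x ∈ Icc 0 L, φ x = 0 := by
    have := hφz (2 * n + 2) le_rfl
    rwa [hyL] at this
  -- p vanishes on a set of positive measure
  have hae : ∀ᵐ x ∂(volume.restrict (Ioc 0 L)), q x * p x ^ 2 = 0 := by
    rw [integral_of_le hL.le] at hqpz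
    exact (setIntegral_eq_zero_iff_of_nonneg_ae hqp0
      ((intervalIntegrable_iff_integrableOn_Ioc_of_le hL.le).1 hqp)).1 hqpz
  have hp0 : ∀ x, p x = 0 := by
    refine cos_zero L n β ((Ioo 0 L ∩ {x | k ^ 2 < a x}) ∩ {x | p x = 0}) ?_ ?_ ?_
    · exact fun x hx => ⟨hx.1.1.1.le, hx.1.1.2.le⟩
    · refine lt_of_lt_of_le hprec₂ (measure_mono_ae ?_)
      have h1 := (ae_restrict_iff' measurableSet_Ioc).1 hae
      filter_upwards [h1] with x hx hx2
      refine ⟨hx2, ?_⟩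
      have h3 := hx ⟨hx2.1.1, hx2.1.2.le⟩
      have h4 : q x ≠ 0 := (sub_pos.2 hx2.2).ne'
      have h5 := (mul_eq_zero.1 h3).resolve_left h4
      exact pow_eq_zero_iff (two_ne_zero) |>.1 h5
    · exact fun x hx => hx.2
  have hβ : β = 0 := cos_indep L hL n β hp0
  have hα : α ≠ 0 := by
    intro h
    exact hne (by rw [h, hβ]; rfl)
  intro x hx
  have h1 := hφ0 x hx
  simp only [hφdef, hp0, add_zero] at h1
  rw [← hUu x hx]
  exact (mul_eq_zero.1 h1).resolve_left hα
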